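/- arXiv:1907.10803 — 2 statements merged into one kernel-verified Lean document; each statement's English description precedes it below -/
import Mathlib

section
/- For every finite connected simple graph G on n ≥ 2 vertices and every integer k ≥ 1, there exists a minimal partition {V_1, …, V_s} of the vertex set V with diameter-bound k such that k·(s − 1) ≤ 2n (equivalently, the number of parts s is at most 2n/k + 1). -/
/-- `G` restricted to `S` has diameter at most `k`: every pair of vertices of the
induced subgraph is at extended distance at most `k` (so in particular `G[S]` is
connected whenever `S` has at least two vertices). -/
def DiamLE {V : Type*} (G : SimpleGraph V) (S : Set V) (k : ℕ) : Prop :=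
  ∀ u v : S, (G.induce S).edist u v ≤ (k : ℕ∞)

/-- In a connected graph every vertex other than the root has a neighbour one step closer to it. -/
theorem SimpleGraph.Connected.exists_parent {V : Type*} {G : SimpleGraph V} (hG : G.Connected)
    (ρ v : V) :
    ∃ w, G.dist w ρ = G.dist v ρ - 1 ∧ (v = ρ → w = ρ) ∧ (v ≠ ρ → G.Adj v w) := by
  by_cases hv : v = ρ
  · exact ⟨ρ, by simp [hv]⟩
  · obtain ⟨q, hq⟩ := hG.exists_walk_length_eq_dist v ρ
    cases q with
    | nil => exact absurd rfl hv
    | @cons _ w _ h q =>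
      refine ⟨w, ?_, fun h => absurd h hv, fun _ => h⟩
      have h₁ := SimpleGraph.dist_le q
      have h₂ := hG.dist_triangle (u := v) (v := w) (w := ρ)
      rw [SimpleGraph.dist_eq_one_iff_adj.2 h] at h₂
      rw [SimpleGraph.Walk.length_cons] at hq
      omega

/-- Following a parent function inside `T` for `i` steps bounds the distance in `G[T]` by `i`. -/
theorem edist_induce_le_of_iterate {V : Type*} {G : SimpleGraph V} {p : V → V}
    (hp : ∀ v, p v = v ∨ G.Adj v (p v)) {T : Set V} {a : V} (ha : a ∈ T) (i : ℕ) :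
    ∀ (u : V) (hu : u ∈ T), (∀ j ≤ i, p^[j] u ∈ T) → p^[i] u = a →
      (G.induce T).edist ⟨u, hu⟩ ⟨a, ha⟩ ≤ (i : ℕ∞) := by
  induction i with
  | zero =>
    rintro u hu - rfl
    simp
  | succ i ih =>
    intro u hu hT hi
    have hpu : p u ∈ T := hT 1 (by omega)
    have h₁ := ih (p u) hpu (fun j hj => hT (j + 1) (by omega)) hi
    have h₂ : (G.induce T).edist ⟨u, hu⟩ ⟨p u, hpu⟩ ≤ 1 := by
      rcases hp u with h | h
      · simp [h]
      · exact (SimpleGraph.edist_eq_one_iff_adj.2 (by simpa using h)).le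
    calc (G.induce T).edist ⟨u, hu⟩ ⟨a, ha⟩
        ≤ (G.induce T).edist ⟨u, hu⟩ ⟨p u, hpu⟩ + (G.induce T).edist ⟨p u, hpu⟩ ⟨a, ha⟩ :=
          SimpleGraph.edist_triangle
      _ ≤ 1 + i := add_le_add h₂ h₁
      _ = ((i + 1 : ℕ) : ℕ∞) := by push_cast; ring

/-- A set of vertices all of which reach `a` within `r` parent steps inside the set has
diameter at most `2 * r`. -/
theorem DiamLE.of_iterate {V : Type*} {G : SimpleGraph V} {p : V → V}
    (hp : ∀ v, p v = v ∨ G.Adj v (p v)) {T : Set V} {a : V} {r k : ℕ} (hrk : 2 * r ≤ k)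
    (hT : ∀ u ∈ T, ∃ i ≤ r, p^[i] u = a ∧ ∀ j ≤ i, p^[j] u ∈ T) : DiamLE G T k := by
  have key (u : V) (hu : u ∈ T) (ha : a ∈ T) :
      (G.induce T).edist ⟨u, hu⟩ ⟨a, ha⟩ ≤ (r : ℕ∞) := by
    obtain ⟨i, hi, hia, hj⟩ := hT u hu
    exact (edist_induce_le_of_iterate hp ha i u hu hj hia).trans (by exact_mod_cast hi)
  rintro ⟨u, hu⟩ ⟨v, hv⟩
  have ha : a ∈ T := by
    obtain ⟨i, -, hia, hj⟩ := hT u hu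
    exact hia ▸ hj i le_rfl
  calc (G.induce T).edist ⟨u, hu⟩ ⟨v, hv⟩
      ≤ (G.induce T).edist ⟨u, hu⟩ ⟨a, ha⟩ + (G.induce T).edist ⟨a, ha⟩ ⟨v, hv⟩ :=
        SimpleGraph.edist_triangle
    _ ≤ r + r := add_le_add (key u hu ha) (by rw [SimpleGraph.edist_comm]; exact key v hv ha)
    _ ≤ k := by
      have : r + r ≤ k := by omega
      exact_mod_cast this

/-- A parent-closed set `S` of vertices can be divided into at most `|S| / (r + 1) + 1` parts of
diameter at most `k`, where `2 * r ≤ k`. -/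
theorem exists_labelling_of_parent_closed {V : Type*} [DecidableEq V] {G : SimpleGraph V}
    {p : V → V} {d : V → ℕ} {ρ : V} (hp : ∀ v, p v = v ∨ G.Adj v (p v))
    (hd : ∀ v, d (p v) = d v - 1) (hρ : ∀ v, d v = 0 → v = ρ) {r k : ℕ} (hrk : 2 * r ≤ k)
    (S : Finset V) (hS : ∀ v ∈ S, p v ∈ S) :
    ∃ c : V → V, (∀ x ∈ S, c x ∈ S) ∧ (∀ y, DiamLE G {x | x ∈ S ∧ c x = y} k) ∧
      (r + 1) * (S.image c).card ≤ S.card + (r + 1) := by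
  have hdi (i : ℕ) (v : V) : d (p^[i] v) = d v - i := by
    induction i with
    | zero => simp
    | succ i ih => rw [Function.iterate_succ_apply', hd, ih]; omega
  induction S using Finset.strongInduction with
  | H S ih =>
  have hSi (i : ℕ) (v : V) (hv : v ∈ S) : p^[i] v ∈ S := by
    induction i with
    | zero => exact hv
    | succ i ih => rw [Function.iterate_succ_apply']; exact hS _ ih
  rcases S.eq_empty_or_nonempty with rfl | hne
  · refine ⟨id, by simp, fun y => ?_, by simp⟩
    rintro ⟨u, hu⟩
    simp at hu
  obtain ⟨v, hv, hmax⟩ := S.exists_max_image d hne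
  by_cases hvr : d v ≤ r
  · have hroot (u : V) (hu : u ∈ S) : p^[r] u = ρ :=
      hρ _ (by rw [hdi]; have := hmax u hu; omega)
    have hρS : ρ ∈ S := hroot v hv ▸ hSi r v hv
    refine ⟨fun _ => ρ, fun _ _ => hρS, fun y => ?_, ?_⟩
    · refine DiamLE.of_iterate (a := ρ) hp hrk ?_
      rintro u ⟨hu, hy⟩
      exact ⟨r, le_rfl, hroot u hu, fun j _ => ⟨hSi j u hu, hy⟩⟩
    · rw [Finset.image_const hne]
      simp
  · obtain ⟨a, ha⟩ : ∃ a, p^[r] v = a := ⟨_, rfl⟩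
    have hda : d a = d v - r := by rw [← ha, hdi]
    have haS : a ∈ S := ha ▸ hSi r v hv
    obtain ⟨T, hT⟩ : ∃ T : Finset V, ∀ u, u ∈ T ↔ u ∈ S ∧ ∃ i ≤ r, p^[i] u = a := by
      classical exact ⟨S.filter fun u => ∃ i ≤ r, p^[i] u = a, fun u => by simp⟩
    have haT : a ∈ T := (hT a).2 ⟨haS, 0, by omega, rfl⟩
    have hTS : T ⊆ S := fun u hu => ((hT u).1 hu).1
    have hTj (j u) (hu : u ∈ S) (i) (hir : i ≤ r) (hia : p^[i] u = a) (hj : j ≤ i) :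
        p^[j] u ∈ T := by
      refine (hT _).2 ⟨hSi j u hu, i - j, by omega, ?_⟩
      rw [← Function.iterate_add_apply, Nat.sub_add_cancel hj, hia]
    have hTdiam : DiamLE G (T : Set V) k := by
      refine DiamLE.of_iterate (a := a) hp hrk fun u hu => ?_
      obtain ⟨hu, i, hir, hia⟩ := (hT u).1 hu
      exact ⟨i, hir, hia, fun j hj => hTj j u hu i hir hia hj⟩
    have hTcard : r + 1 ≤ T.card := by
      have hinj : Set.InjOn (fun j => p^[j] v) (Finset.range (r + 1) : Set ℕ) := by
        intro i hi j hj hij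
        have := congrArg d hij
        simp only [hdi, Finset.coe_range, Set.mem_Iio] at this hi hj
        omega
      calc r + 1 = ((Finset.range (r + 1)).image fun j => p^[j] v).card := by
            rw [Finset.card_image_of_injOn hinj, Finset.card_range]
        _ ≤ T.card := Finset.card_le_card fun x hx => by
            obtain ⟨j, hj, rfl⟩ := Finset.mem_image.1 hx
            exact hTj j v hv r le_rfl ha (by simpa [Nat.lt_succ_iff] using hj)
    obtain ⟨c, hcS, hc, hcard⟩ := ih (S \ T) (Finset.sdiff_ssubset hTS ⟨a, haT⟩) (by
      intro u hu
      rw [Finset.mem_sdiff] at hu ⊢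
      refine ⟨hS u hu.1, fun hpu => hu.2 ?_⟩
      obtain ⟨-, i, hir, hia⟩ := (hT _).1 hpu
      refine (hT u).2 ⟨hu.1, i + 1, ?_, hia⟩
      have h₁ := hdi (i + 1) u
      rw [Function.iterate_succ_apply, hia] at h₁
      have h₂ := hmax u hu.1
      omega)
    refine ⟨fun x => if x ∈ T then a else c x, fun x hx => ?_, fun y => ?_, ?_⟩
    · by_cases hxT : x ∈ T
      · simpa [hxT] using haS
      · simpa [hxT] using (Finset.mem_sdiff.1 (hcS x (by simp [hx, hxT]))).1
    · by_cases hy : y = a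
      · convert hTdiam using 1
        ext x
        by_cases hxT : x ∈ T
        · simp [hxT, hTS hxT, hy]
        · simp only [hxT, if_false, Set.mem_ofPred_eq, Finset.mem_coe, iff_false]
          rintro ⟨hx, h⟩
          exact (Finset.mem_sdiff.1 (hcS x (by simp [hx, hxT]))).2 (by rwa [h, hy])
      · convert hc y using 1
        ext x
        by_cases hxT : x ∈ T
        · simp [hxT, Ne.symm hy]
        · simp [hxT]
    · have hsub : S.image (fun x => if x ∈ T then a else c x) ⊆ insert a ((S \ T).image c) := by
        intro y hy
        obtain ⟨x, hx, rfl⟩ := Finset.mem_image.1 hy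
        by_cases hxT : x ∈ T
        · simp [hxT]
        · simp only [hxT, if_false]
          exact Finset.mem_insert_of_mem (Finset.mem_image_of_mem c (by simp [hx, hxT]))
      have h₁ := (Finset.card_le_card hsub).trans (Finset.card_insert_le _ _)
      have h₂ := Finset.card_sdiff_add_card_eq_card hTS
      have h₃ := Nat.mul_le_mul_left (r + 1) h₁
      rw [mul_add] at h₃
      omega

/-- A labelling with parts of diameter at most `k` and the fewest labels cannot have two parts
merged. -/
theorem exists_labelling_minimal {V : Type*} [Fintype V] [DecidableEq V] (G : SimpleGraph V)
    (k : ℕ) (c₀ : V → V) (h₀ : ∀ y, DiamLE G {x | c₀ x = y} k) :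
    ∃ c : V → V, (∀ y, DiamLE G {x | c x = y} k) ∧
      (Finset.univ.image c).card ≤ (Finset.univ.image c₀).card ∧
      ∀ i ∈ Finset.univ.image c, ∀ j ∈ Finset.univ.image c, i ≠ j →
        ¬ DiamLE G ({x | c x = i} ∪ {x | c x = j}) k := by
  obtain ⟨c, hc, hmin⟩ := Set.exists_min_image {c : V → V | ∀ y, DiamLE G {x | c x = y} k}
    (fun c => (Finset.univ.image c).card) (Set.toFinite _) ⟨c₀, h₀⟩
  refine ⟨c, hc, hmin c₀ h₀, fun i hi j hj hij hdiam => ?_⟩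
  have hle := hmin (fun x => if c x = j then i else c x) fun y => by
    by_cases hyi : y = i
    · convert hdiam using 1
      ext x
      by_cases hx : c x = j <;> simp [hx, hyi]
    · by_cases hyj : y = j
      · rintro ⟨x, hx⟩
        by_cases hxj : c x = j
        · simp [hxj, Ne.symm hyi] at hx
        · simp [hxj, hyj] at hx
      · convert hc y using 1
        ext x
        by_cases hx : c x = j
        · simp [hx, Ne.symm hyi, Ne.symm hyj]
        · simp [hx]
  have hsub : Finset.univ.image (fun x => if c x = j then i else c x) ⊆
      (Finset.univ.image c).erase j := by
    intro y hy
    obtain ⟨x, -, rfl⟩ := Finset.mem_image.1 hy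
    by_cases hx : c x = j
    · simpa [hx, hij] using hi
    · simp [hx]
  have hlt := (Finset.card_le_card hsub).trans_lt (Finset.card_erase_lt_of_mem hj)
  exact absurd hle (not_le.2 hlt)

/-- every finite connected simple graph on `n ≥ 2` vertices admits,
for each integer `k ≥ 1`, a minimal partition with diameter-bound `k` whose
number of parts `s` satisfies `k * (s - 1) ≤ 2 * n`. -/
theorem minimal_k_grouping_size_bound
    {V : Type*} [Fintype V] (G : SimpleGraph V) (hG : G.Connected)
    (hn : 2 ≤ Fintype.card V) (k : ℕ) (hk : 1 ≤ k) :
    ∃ (s : ℕ) (P : Fin s → Set V),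
      (∀ i, (P i).Nonempty) ∧
      (Pairwise fun i j => Disjoint (P i) (P j)) ∧
      (⋃ i, P i) = Set.univ ∧
      (∀ i, DiamLE G (P i) k) ∧
      (∀ i j, i ≠ j → ¬ DiamLE G (P i ∪ P j) k) ∧
      k * (s - 1) ≤ 2 * Fintype.card V := by
  classical
  obtain ⟨ρ⟩ := hG.nonempty
  choose p hpd hpρ hpadj using hG.exists_parent ρ
  obtain ⟨c₀, -, h₀, hcard₀⟩ := exists_labelling_of_parent_closed (G := G) (p := p)
    (d := fun v => G.dist v ρ) (ρ := ρ) (r := k / 2) (k := k)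
    (fun v => by
      by_cases hv : v = ρ
      · exact Or.inl ((hpρ v hv).trans hv.symm)
      · exact Or.inr (hpadj v hv))
    hpd (fun v hv => hG.dist_eq_zero_iff.1 hv) (by omega) Finset.univ (by simp)
  obtain ⟨c, hc, hcard, hmerge⟩ := exists_labelling_minimal G k c₀ (by simpa using h₀)
  let e := (Finset.univ.image c).equivFin
  refine ⟨(Finset.univ.image c).card, fun i => {x | c x = e.symm i}, fun i => ?_,
    fun i j hij => ?_, ?_, fun i => hc _, fun i j hij => ?_, ?_⟩
  · obtain ⟨x, -, hx⟩ := Finset.mem_image.1 (e.symm i).2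
    exact ⟨x, hx⟩
  · refine Set.disjoint_left.2 fun x (hi : c x = _) (hj : c x = _) => hij ?_
    exact e.symm.injective (Subtype.ext (hi.symm.trans hj))
  · refine Set.eq_univ_of_forall fun x => Set.mem_iUnion.2
      ⟨e ⟨c x, Finset.mem_image_of_mem c (Finset.mem_univ x)⟩, ?_⟩
    simp
  · exact hmerge _ (e.symm i).2 _ (e.symm j).2 fun h => hij (e.symm.injective (Subtype.ext h))
  · rw [Finset.card_univ] at hcard₀
    have h₁ : (k / 2 + 1) * ((Finset.univ.image c).card - 1) ≤ Fintype.card V := by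
      have := Nat.mul_le_mul_left (k / 2 + 1) hcard
      rw [Nat.mul_sub, mul_one]
      omega
    calc k * ((Finset.univ.image c).card - 1)
        ≤ (2 * (k / 2 + 1)) * ((Finset.univ.image c).card - 1) :=
          Nat.mul_le_mul_right _ (by omega)
      _ ≤ 2 * Fintype.card V := by rw [mul_assoc]; exact Nat.mul_le_mul_left 2 h₁
end

section
/- Let G be a finite simple graph with vertex set V, let k ≥ 0 be an integer, and let g_1, g_2 ⊆ V be disjoint sets such that G[g_1] and G[g_2] are connected with D(G[g_1]) ≤ k and D(G[g_2]) ≤ k, and such that some vertex of g_1 is adjacent in G to some vertex of g_2. If D(G[g_1 ∪ g_2]) > k, then there exist v ∈ g_1 and u ∈ g_2 with d_{G[g_1 ∪ g_2]}(v, u) = k + 1. -/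
namespace SimpleGraph

variable {V W : Type*} {G : SimpleGraph V} {H : SimpleGraph W}

theorem edist_map_le (f : G →g H) (u v : V) : H.edist (f u) (f v) ≤ G.edist u v := by
  by_cases h : G.Reachable u v
  · obtain ⟨p, hp⟩ := h.exists_walk_length_eq_edist
    rw [← hp, ← p.length_map f]
    exact edist_le (p.map f)
  · rw [edist_eq_top_of_not_reachable h]
    exact le_top

theorem edist_le_edist_add_one (x : V) {u v : V} (h : G.Adj u v) :
    G.edist x v ≤ G.edist x u + 1 := by
  calc G.edist x v ≤ G.edist x u + G.edist u v := G.edist_triangle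
    _ = G.edist x u + 1 := by rw [edist_eq_one_iff_adj.mpr h]

/-- A discrete intermediate value theorem for the distance from `x` along a walk. -/
theorem Walk.exists_edist_eq_add_one (f : G →g H) (x : W) (n : ℕ) {b v : V} (p : G.Walk b v)
    (hb : H.edist x (f b) ≤ n + 1) (hv : (n : ℕ∞) < H.edist x (f v)) :
    ∃ w, H.edist x (f w) = n + 1 := by
  induction p with
  | nil => exact ⟨_, le_antisymm hb (Order.add_one_le_of_lt hv)⟩
  | cons h p ih =>
    rename_i a b' _
    by_cases hle : H.edist x (f a) ≤ n
    · exact ih ((edist_le_edist_add_one x (f.map_adj h)).trans (by gcongr)) hv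
    · exact ⟨a, le_antisymm hb (Order.add_one_le_of_lt (not_le.mp hle))⟩

theorem exists_edist_eq_add_one_of_adj {U : Type*} {K : SimpleGraph U} (f : G →g H) (g : K →g H)
    (n : ℕ) (hG : ∀ u v, G.edist u v ≤ n) (hK : K.Connected) {a : V} {b : U}
    (hab : H.Adj (f a) (g b)) {x : V} {y : U} (hxy : (n : ℕ∞) < H.edist (f x) (g y)) :
    ∃ w, H.edist (f x) (g w) = n + 1 := by
  obtain ⟨p⟩ := hK.preconnected b y
  refine p.exists_edist_eq_add_one g (f x) n ?_ hxy
  refine (edist_le_edist_add_one (f x) hab).trans ?_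
  gcongr
  exact (edist_map_le f x a).trans (hG x a)

end SimpleGraph

/-- if two disjoint groups each induce a connected subgraph of
diameter at most `k`, are joined by at least one edge, and their union induces a
subgraph of diameter greater than `k`, then some vertex of the first group and
some vertex of the second group are at distance exactly `k + 1` in the induced
subgraph on the union. -/
theorem unmergeable_witness_distance
    {V : Type*} [Fintype V] (G : SimpleGraph V) (k : ℕ)
    (g₁ g₂ : Set V) (hdisj : Disjoint g₁ g₂)
    (hc₁ : (G.induce g₁).Connected) (hc₂ : (G.induce g₂).Connected)
    (hd₁ : ∀ u v : g₁, (G.induce g₁).edist u v ≤ (k : ℕ∞))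
    (hd₂ : ∀ u v : g₂, (G.induce g₂).edist u v ≤ (k : ℕ∞))
    (hadj : ∃ v₁ ∈ g₁, ∃ v₂ ∈ g₂, G.Adj v₁ v₂)
    (hbig : ∃ u v : ↥(g₁ ∪ g₂), (k : ℕ∞) < (G.induce (g₁ ∪ g₂)).edist u v) :
    ∃ v u : ↥(g₁ ∪ g₂), ↑v ∈ g₁ ∧ ↑u ∈ g₂ ∧
      (G.induce (g₁ ∪ g₂)).edist v u = (k + 1 : ℕ∞) := by
  let i₁ := SimpleGraph.induceHomOfLE G (Set.subset_union_left (s := g₁) (t := g₂))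
  let i₂ := SimpleGraph.induceHomOfLE G (Set.subset_union_right (s := g₁) (t := g₂))
  obtain ⟨a, ha, b, hb, hab⟩ := hadj
  have cross {x : g₁} {y : g₂}
      (hxy : (k : ℕ∞) < (G.induce (g₁ ∪ g₂)).edist (i₁ x) (i₂ y)) :
      ∃ v u : ↥(g₁ ∪ g₂), ↑v ∈ g₁ ∧ ↑u ∈ g₂ ∧
        (G.induce (g₁ ∪ g₂)).edist v u = (k + 1 : ℕ∞) := by
    obtain ⟨w, hw⟩ := SimpleGraph.exists_edist_eq_add_one_of_adj i₁.toHom i₂.toHom k hd₁ hc₂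
      (a := ⟨a, ha⟩) (b := ⟨b, hb⟩) hab hxy
    exact ⟨i₁ x, i₂ w, x.2, w.2, hw⟩
  obtain ⟨⟨u, hu | hu⟩, ⟨v, hv | hv⟩, huv⟩ := hbig
  · exact absurd huv (not_lt.mpr
      ((SimpleGraph.edist_map_le i₁.toHom ⟨u, hu⟩ ⟨v, hv⟩).trans (hd₁ _ _)))
  · exact cross (x := ⟨u, hu⟩) (y := ⟨v, hv⟩) huv
  · rw [SimpleGraph.edist_comm] at huv
    exact cross (x := ⟨v, hv⟩) (y := ⟨u, hu⟩) huv
  · exact absurd huv (not_lt.mpr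
      ((SimpleGraph.edist_map_le i₂.toHom ⟨u, hu⟩ ⟨v, hv⟩).trans (hd₂ _ _)))
end
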